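/- Let n, m, ℓ be positive integers with 2n ≤ m and ℓ ≤ n, and let H = ∪_{u∈[n]} H_u be a 3-uniform hypergraph on [n] with m hyperedges, partitioned so that every C ∈ H_u contains u, and such that |C₁ ∩ C₂| ≤ 1 for all distinct hyperedges C₁, C₂ ∈ H. Let b_C ∈ {−1,1} be arbitrary signs and let A ∈ ℝ^{n^ℓ × n^ℓ} be the associated Wein–El Alaoui–Moore Kikuchi matrix. Then ‖A‖₂ ≥ ℓ'(ℓ'−1)/2, where ℓ' := min(⌈m/(2n)⌉, ℓ) and ‖·‖₂ denotes the spectral norm. -/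

import Mathlib

open Finset
open scoped Classical

/-- The Wein–El Alaoui–Moore relation `S⃗ ↔^{C₁,C₂} T⃗` for `C₁ = {u,v₁,w₁}` and
`C₂ = {u,v₂,w₂}`: there are positions `i ≠ j` such that `S⃗` and `T⃗` agree off `{i,j}`,
the (multiset of) entries `{S⃗_i, S⃗_j}` contains exactly one element of each of
`{v₁,w₁}` and `{v₂,w₂}`, and `{T⃗_i, T⃗_j}` consists of the two remaining elements. -/
def wamRel (n ℓ : ℕ) (v₁ w₁ v₂ w₂ : Fin n) (S T : Fin ℓ → Fin n) : Prop :=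
  ∃ i j : Fin ℓ, i ≠ j ∧ (∀ s, s ≠ i → s ≠ j → S s = T s) ∧
    ∃ a₁ b₁ a₂ b₂ : Fin n,
      ({a₁, b₁} : Multiset (Fin n)) = {v₁, w₁} ∧
      ({a₂, b₂} : Multiset (Fin n)) = {v₂, w₂} ∧
      ({S i, S j} : Multiset (Fin n)) = {a₁, a₂} ∧
      ({T i, T j} : Multiset (Fin n)) = {b₁, b₂}

/-- The Wein–El Alaoui–Moore Kikuchi matrix `A = Σ_u A_u` for a partitioned 3-uniform
hypergraph `B : Fin n → Finset (Finset (Fin n))` with signs `b`. The entry `A_u(S⃗,T⃗)`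
equals `b_{C₁}·b_{C₂}` when `S⃗ ↔^{C₁,C₂} T⃗` holds for a pair of distinct
`C₁, C₂ ∈ B u` (the relation is symmetric in the pair, and the pair is unique when it
exists; hence the factor `1/2` in the sum over ordered pairs). -/
noncomputable def wamMatrix (n ℓ : ℕ) (B : Fin n → Finset (Finset (Fin n)))
    (b : Finset (Fin n) → ℝ) (S T : Fin ℓ → Fin n) : ℝ :=
  ∑ u : Fin n, (1/2 : ℝ) * ∑ C₁ ∈ B u, ∑ C₂ ∈ B u,
    if C₁ ≠ C₂ ∧ ∃ v₁ w₁ v₂ w₂ : Fin n,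
        C₁ = {u, v₁, w₁} ∧ C₂ = {u, v₂, w₂} ∧
        ({v₁, w₁} ∩ {v₂, w₂} : Finset (Fin n)) = ∅ ∧
        wamRel n ℓ v₁ w₁ v₂ w₂ S T
    then b C₁ * b C₂ else 0

theorem Multiset.pair_eq_pair_iff {α : Type*} {a b c d : α} :
    ({a, b} : Multiset α) = {c, d} ↔ (a = c ∧ b = d) ∨ (a = d ∧ b = c) := by
  constructor
  · intro h
    have h' : (Multiset.cons a {b}) = Multiset.cons c {d} := h
    rw [Multiset.cons_eq_cons] at h'
    rcases h' with ⟨h1, h2⟩ | ⟨_, cs, h1, h2⟩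
    · exact Or.inl ⟨h1, Multiset.singleton_inj.mp h2⟩
    · right
      have h3 := congrArg Multiset.card h1
      simp only [Multiset.card_singleton, Multiset.card_cons] at h3
      have h4 : cs = 0 := Multiset.card_eq_zero.mp (by omega)
      subst h4
      simp only [Multiset.cons_zero, Multiset.singleton_inj] at h1 h2
      exact ⟨h2.symm, h1⟩
  · rintro (⟨rfl, rfl⟩ | ⟨rfl, rfl⟩)
    · rfl
    · exact Multiset.pair_comm _ _

/-- `{u, a, c}` and `{u, b, d}` are the hyperedges `C₁` and `C₂`. -/
def EdgePair {n : ℕ} (u : Fin n) (C₁ C₂ : Finset (Fin n)) (a b c d : Fin n) : Prop :=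
  C₁ = {u, a, c} ∧ C₂ = {u, b, d}

theorem Finset.ne_of_card_triple {α : Type*} [DecidableEq α] {x y z : α}
    (h : ({x, y, z} : Finset α).card = 3) : x ≠ y ∧ x ≠ z ∧ y ≠ z := by
  refine ⟨?_, ?_, ?_⟩ <;> rintro rfl
  · have := Finset.card_le_two (a := x) (b := z)
    simp at h
    omega
  · have := Finset.card_le_two (a := x) (b := y)
    rw [Finset.insert_eq_of_mem (by simp), Finset.pair_comm] at h
    omega
  · have := Finset.card_le_two (a := x) (b := y)
    rw [Finset.pair_eq_singleton] at h
    omega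

theorem Finset.eq_of_mem_inter_of_card_le_one {α : Type*} [DecidableEq α] {s t : Finset α}
    (h : (s ∩ t).card ≤ 1) {x y : α} (hxs : x ∈ s) (hxt : x ∈ t) (hys : y ∈ s) (hyt : y ∈ t) :
    x = y :=
  Finset.card_le_one.mp h x (Finset.mem_inter.mpr ⟨hxs, hxt⟩) y (Finset.mem_inter.mpr ⟨hys, hyt⟩)

/-- If two triples through `u` share only `u`, each of their further points lies in exactly
one of them. -/
theorem EdgePair.separated {n : ℕ} {u : Fin n} {C₁ C₂ : Finset (Fin n)} {a b c d : Fin n}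
    (h : EdgePair u C₁ C₂ a b c d) (h₁ : C₁.card = 3) (h₂ : C₂.card = 3)
    (h₁₂ : (C₁ ∩ C₂).card ≤ 1) :
    (a ∈ C₁ ∧ c ∈ C₁ ∧ b ∈ C₂ ∧ d ∈ C₂) ∧ (a ∉ C₂ ∧ c ∉ C₂ ∧ b ∉ C₁ ∧ d ∉ C₁) ∧
      a ≠ c ∧ b ≠ d := by
  obtain ⟨rfl, rfl⟩ := h
  obtain ⟨ha, hc, hac⟩ := Finset.ne_of_card_triple h₁
  obtain ⟨hb, hd, hbd⟩ := Finset.ne_of_card_triple h₂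
  have key : ∀ x, x ∈ ({u, a, c} : Finset (Fin n)) → x ∈ ({u, b, d} : Finset (Fin n)) → u = x :=
    fun x hx₁ hx₂ => Finset.eq_of_mem_inter_of_card_le_one h₁₂ (by simp) (by simp) hx₁ hx₂
  exact ⟨⟨by simp, by simp, by simp, by simp⟩,
    ⟨fun h => ha (key _ (by simp) h), fun h => hc (key _ (by simp) h),
      fun h => hb (key _ h (by simp)), fun h => hd (key _ h (by simp))⟩, hac, hbd⟩

theorem wamRel_edges_iff {n ℓ : ℕ} {u : Fin n} {C₁ C₂ : Finset (Fin n)}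
    (h₁ : C₁.card = 3) (h₁₂ : (C₁ ∩ C₂).card ≤ 1) (S T : Fin ℓ → Fin n) :
    (∃ v₁ w₁ v₂ w₂ : Fin n, C₁ = {u, v₁, w₁} ∧ C₂ = {u, v₂, w₂} ∧
        ({v₁, w₁} ∩ {v₂, w₂} : Finset (Fin n)) = ∅ ∧ wamRel n ℓ v₁ w₁ v₂ w₂ S T) ↔
      ∃ i j : Fin ℓ, (i ≠ j ∧ ∀ s, s ≠ i → s ≠ j → S s = T s) ∧
        (EdgePair u C₁ C₂ (S i) (S j) (T i) (T j) ∨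
          EdgePair u C₁ C₂ (S i) (S j) (T j) (T i)) := by
  have comm : ∀ x y : Fin n, ({u, x, y} : Finset (Fin n)) = {u, y, x} := fun x y => by
    rw [Finset.pair_comm]
  constructor
  · rintro ⟨v₁, w₁, v₂, w₂, e₁, e₂, -, i, j, hij, hoff, a₁, b₁, a₂, b₂, m₁, m₂, mS, mT⟩
    have f₁ : C₁ = {u, a₁, b₁} := by
      rcases Multiset.pair_eq_pair_iff.mp m₁ with ⟨rfl, rfl⟩ | ⟨rfl, rfl⟩
      · exact e₁
      · rw [e₁, comm]
    have f₂ : C₂ = {u, a₂, b₂} := by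
      rcases Multiset.pair_eq_pair_iff.mp m₂ with ⟨rfl, rfl⟩ | ⟨rfl, rfl⟩
      · exact e₂
      · rw [e₂, comm]
    rcases Multiset.pair_eq_pair_iff.mp mS with ⟨s₁, s₂⟩ | ⟨s₁, s₂⟩ <;>
      rcases Multiset.pair_eq_pair_iff.mp mT with ⟨t₁, t₂⟩ | ⟨t₁, t₂⟩
    · exact ⟨i, j, ⟨hij, hoff⟩, Or.inl ⟨by rw [s₁, t₁, f₁], by rw [s₂, t₂, f₂]⟩⟩
    · exact ⟨i, j, ⟨hij, hoff⟩, Or.inr ⟨by rw [s₁, t₂, f₁], by rw [s₂, t₁, f₂]⟩⟩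
    · exact ⟨j, i, ⟨hij.symm, fun s h h' => hoff s h' h⟩,
        Or.inr ⟨by rw [s₂, t₁, f₁], by rw [s₁, t₂, f₂]⟩⟩
    · exact ⟨j, i, ⟨hij.symm, fun s h h' => hoff s h' h⟩,
        Or.inl ⟨by rw [s₂, t₂, f₁], by rw [s₁, t₁, f₂]⟩⟩
  · have disj : ∀ {a b c d : Fin n}, EdgePair u C₁ C₂ a b c d →
        ({a, c} ∩ {b, d} : Finset (Fin n)) = ∅ := by
      rintro a b c d ⟨rfl, rfl⟩
      obtain ⟨ha, hc, -⟩ := Finset.ne_of_card_triple h₁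
      refine Finset.eq_empty_of_forall_notMem fun x hx => ?_
      rw [Finset.mem_inter] at hx
      have hux : u = x := Finset.eq_of_mem_inter_of_card_le_one h₁₂ (by simp) (by simp)
        (Finset.mem_insert_of_mem hx.1) (Finset.mem_insert_of_mem hx.2)
      have := hx.1
      simp only [Finset.mem_insert, Finset.mem_singleton] at this
      rcases this with rfl | rfl
      · exact ha hux
      · exact hc hux
    rintro ⟨i, j, ⟨hij, hoff⟩, h | h⟩
    · exact ⟨S i, T i, S j, T j, h.1, h.2, disj h, i, j, hij, hoff, _, _, _, _, rfl, rfl, rfl, rfl⟩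
    · exact ⟨S i, T j, S j, T i, h.1, h.2, disj h, i, j, hij, hoff, _, _, _, _, rfl, rfl, rfl,
        Multiset.pair_comm _ _⟩

/-- The contribution of ordered pairs of distinct hyperedges to the transition
`(a, b) → (c, d)` in which `a` is replaced by `c` and `b` by `d`. -/
noncomputable def pairKernel {n : ℕ} (B : Fin n → Finset (Finset (Fin n)))
    (w : Finset (Fin n) → ℝ) (a b c d : Fin n) : ℝ :=
  ∑ u : Fin n, ∑ C₁ ∈ B u, ∑ C₂ ∈ B u,
    if C₁ ≠ C₂ ∧ EdgePair u C₁ C₂ a b c d then w C₁ * w C₂ else 0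

/-- An ordered pair of hyperedges realizes a transition at only one ordered pair of positions,
and in only one way. -/
theorem sum_edgePair_eq_ite {n ℓ : ℕ} {u : Fin n} {C₁ C₂ : Finset (Fin n)}
    (h₁ : C₁.card = 3) (h₂ : C₂.card = 3) (h₁₂ : (C₁ ∩ C₂).card ≤ 1) (S T : Fin ℓ → Fin n) :
    (∑ i, ∑ j, if i ≠ j ∧ ∀ s, s ≠ i → s ≠ j → S s = T s then
        (if EdgePair u C₁ C₂ (S i) (S j) (T i) (T j) then (1 : ℝ) else 0) +
          (if EdgePair u C₁ C₂ (S i) (S j) (T j) (T i) then 1 else 0) else 0) =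
      if ∃ i j : Fin ℓ, (i ≠ j ∧ ∀ s, s ≠ i → s ≠ j → S s = T s) ∧
        (EdgePair u C₁ C₂ (S i) (S j) (T i) (T j) ∨
          EdgePair u C₁ C₂ (S i) (S j) (T j) (T i)) then 1 else 0 := by
  have both : ∀ {a b c d : Fin n}, EdgePair u C₁ C₂ a b c d → EdgePair u C₁ C₂ a b d c →
      False := fun h h' =>
    (h.separated h₁ h₂ h₁₂).2.1.2.2.2 (h'.separated h₁ h₂ h₁₂).1.2.1
  have sep : ∀ {i j : Fin ℓ}, (EdgePair u C₁ C₂ (S i) (S j) (T i) (T j) ∨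
      EdgePair u C₁ C₂ (S i) (S j) (T j) (T i)) →
      (S i ∈ C₁ ∧ S j ∉ C₁) ∧ S i ≠ T i ∧ S j ≠ T j := by
    rintro i j (h | h)
    · obtain ⟨⟨m₁, m₂, m₃, m₄⟩, ⟨n₁, n₂, n₃, n₄⟩, e₁, e₂⟩ := h.separated h₁ h₂ h₁₂
      exact ⟨⟨m₁, n₃⟩, e₁, e₂⟩
    · obtain ⟨⟨m₁, m₂, m₃, m₄⟩, ⟨n₁, n₂, n₃, n₄⟩, e₁, e₂⟩ := h.separated h₁ h₂ h₁₂
      exact ⟨⟨m₁, n₃⟩, fun e => n₁ (e ▸ m₄), fun e => n₃ (e ▸ m₂)⟩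
  split_ifs with hex
  · obtain ⟨i, j, ⟨hij, hoff⟩, h⟩ := hex
    obtain ⟨⟨hi, hj⟩, hi', hj'⟩ := sep h
    have uniq : ∀ i' j', (i' ≠ j' ∧ ∀ s, s ≠ i' → s ≠ j' → S s = T s) →
        (EdgePair u C₁ C₂ (S i') (S j') (T i') (T j') ∨
          EdgePair u C₁ C₂ (S i') (S j') (T j') (T i')) → i' = i ∧ j' = j := by
      rintro i' j' - g
      obtain ⟨⟨ki, kj⟩, ki', kj'⟩ := sep g
      constructor
      · by_contra hne
        exact ki' (hoff i' hne fun e => hj (e ▸ ki))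
      · by_contra hne
        exact kj' (hoff j' (fun e => kj (e ▸ hi)) hne)
    have zero : ∀ i' j', ¬ (i' = i ∧ j' = j) →
        (if i' ≠ j' ∧ ∀ s, s ≠ i' → s ≠ j' → S s = T s then
          (if EdgePair u C₁ C₂ (S i') (S j') (T i') (T j') then (1 : ℝ) else 0) +
          (if EdgePair u C₁ C₂ (S i') (S j') (T j') (T i') then 1 else 0) else 0) = 0 := by
      intro i' j' hne
      split_ifs with p q r r
      · exact absurd (uniq i' j' p (Or.inl q)) hne
      · exact absurd (uniq i' j' p (Or.inl q)) hne
      · exact absurd (uniq i' j' p (Or.inr r)) hne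
      · simp
      · rfl
    rw [Finset.sum_eq_single i (fun i' _ hne => Finset.sum_eq_zero fun j' _ =>
        zero i' j' fun e => hne e.1) (by simp),
      Finset.sum_eq_single j (fun j' _ hne => zero i j' fun e => hne e.2) (by simp),
      if_pos ⟨hij, hoff⟩]
    rcases h with h | h
    · rw [if_pos h, if_neg fun h' => both h h', add_zero]
    · rw [if_pos h, if_neg fun h' => both h h', zero_add]
  · refine Finset.sum_eq_zero fun i _ => Finset.sum_eq_zero fun j _ => ?_
    split_ifs with p q r r
    · exact absurd ⟨i, j, p, Or.inl q⟩ hex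
    · exact absurd ⟨i, j, p, Or.inl q⟩ hex
    · exact absurd ⟨i, j, p, Or.inr r⟩ hex
    · simp
    · rfl

/-- The Kikuchi matrix as a sum over ordered pairs of positions of a two-body kernel. -/
theorem wamMatrix_eq_sum_pairKernel {n ℓ : ℕ} {B : Fin n → Finset (Finset (Fin n))}
    (w : Finset (Fin n) → ℝ) (h3 : ∀ u, ∀ C ∈ B u, C.card = 3)
    (hint : ∀ C₁ C₂ : Finset (Fin n), (∃ u, C₁ ∈ B u) → (∃ u, C₂ ∈ B u) →
      C₁ ≠ C₂ → (C₁ ∩ C₂).card ≤ 1) (S T : Fin ℓ → Fin n) :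
    wamMatrix n ℓ B w S T =
      1 / 2 * ∑ i, ∑ j, if i ≠ j ∧ ∀ s, s ≠ i → s ≠ j → S s = T s then
        pairKernel B w (S i) (S j) (T i) (T j) + pairKernel B w (S i) (S j) (T j) (T i)
        else 0 := by
  have expand : ∀ i j : Fin ℓ, (if i ≠ j ∧ ∀ s, s ≠ i → s ≠ j → S s = T s then
        pairKernel B w (S i) (S j) (T i) (T j) + pairKernel B w (S i) (S j) (T j) (T i)
        else 0) = ∑ u : Fin n, ∑ C₁ ∈ B u, ∑ C₂ ∈ B u, if C₁ ≠ C₂ then w C₁ * w C₂ *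
        (if i ≠ j ∧ ∀ s, s ≠ i → s ≠ j → S s = T s then
        (if EdgePair u C₁ C₂ (S i) (S j) (T i) (T j) then (1 : ℝ) else 0) +
          (if EdgePair u C₁ C₂ (S i) (S j) (T j) (T i) then 1 else 0) else 0) else 0 := by
    intro i j
    by_cases hp : i ≠ j ∧ ∀ s, s ≠ i → s ≠ j → S s = T s
    · simp only [if_pos hp, pairKernel, ← Finset.sum_add_distrib]
      refine Finset.sum_congr rfl fun u _ => Finset.sum_congr rfl fun C₁ _ =>
        Finset.sum_congr rfl fun C₂ _ => ?_
      by_cases hC : C₁ = C₂ <;> simp [hC, mul_add]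
    · simp only [if_neg hp]
      simp
  simp only [expand]
  rw [wamMatrix, Finset.mul_sum]
  have swap : ∀ F : Fin ℓ → Fin n → Finset (Fin n) → Finset (Fin n) → ℝ,
      ∑ i, ∑ u, ∑ C₁ ∈ B u, ∑ C₂ ∈ B u, F i u C₁ C₂ =
        ∑ u, ∑ C₁ ∈ B u, ∑ C₂ ∈ B u, ∑ i, F i u C₁ C₂ := fun F => by
    rw [Finset.sum_comm]
    refine Finset.sum_congr rfl fun u _ => ?_
    rw [Finset.sum_comm]
    exact Finset.sum_congr rfl fun C₁ _ => Finset.sum_comm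
  simp only [swap, Finset.mul_sum]
  refine Finset.sum_congr rfl fun u _ => Finset.sum_congr rfl fun C₁ h₁ =>
    Finset.sum_congr rfl fun C₂ h₂ => ?_
  by_cases hC : C₁ = C₂
  · simp [hC]
  have hc := hint C₁ C₂ ⟨u, h₁⟩ ⟨u, h₂⟩ hC
  have key := sum_edgePair_eq_ite (u := u) (h3 u C₁ h₁) (h3 u C₂ h₂) hc S T
  simp only [if_pos (show C₁ ≠ C₂ from hC), ← Finset.mul_sum]
  rw [key]
  simp only [ne_eq, hC, not_false_eq_true, true_and,
    wamRel_edges_iff (u := u) (h3 u C₁ h₁) hc S T, mul_ite, mul_one, mul_zero]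

theorem pairKernel_comm_snd {n : ℕ} (B : Fin n → Finset (Finset (Fin n)))
    (w : Finset (Fin n) → ℝ) (a b c d : Fin n) :
    pairKernel B w a b c d = pairKernel B w a d c b := by
  unfold pairKernel
  refine Finset.sum_congr rfl fun u _ => Finset.sum_congr rfl fun C₁ _ =>
    Finset.sum_congr rfl fun C₂ _ => if_congr ?_ rfl rfl
  simp only [EdgePair, Finset.pair_comm b d]

theorem pairKernel_swap {n : ℕ} (B : Fin n → Finset (Finset (Fin n)))
    (w : Finset (Fin n) → ℝ) (a b c d : Fin n) :
    pairKernel B w a b c d = pairKernel B w b a d c := by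
  unfold pairKernel
  refine Finset.sum_congr rfl fun u _ => ?_
  rw [Finset.sum_comm]
  refine Finset.sum_congr rfl fun C₁ _ => Finset.sum_congr rfl fun C₂ _ =>
    if_congr ?_ (mul_comm _ _) rfl
  simp only [EdgePair, ne_comm (a := C₂), and_comm (a := C₂ = _)]

theorem ne_of_pairKernel_ne_zero {n : ℕ} {B : Fin n → Finset (Finset (Fin n))}
    {w : Finset (Fin n) → ℝ} (h3 : ∀ u, ∀ C ∈ B u, C.card = 3)
    (hint : ∀ C₁ C₂ : Finset (Fin n), (∃ u, C₁ ∈ B u) → (∃ u, C₂ ∈ B u) →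
      C₁ ≠ C₂ → (C₁ ∩ C₂).card ≤ 1) {a b c d : Fin n} (h : pairKernel B w a b c d ≠ 0) :
    a ≠ b ∧ a ≠ c ∧ a ≠ d ∧ b ≠ c ∧ b ≠ d ∧ c ≠ d := by
  obtain ⟨u, -, h⟩ := Finset.exists_ne_zero_of_sum_ne_zero h
  obtain ⟨C₁, h₁, h⟩ := Finset.exists_ne_zero_of_sum_ne_zero h
  obtain ⟨C₂, h₂, h⟩ := Finset.exists_ne_zero_of_sum_ne_zero h
  obtain ⟨hC, h⟩ := (ite_ne_right_iff.mp h).1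
  obtain ⟨⟨m₁, m₂, m₃, m₄⟩, ⟨n₁, n₂, n₃, n₄⟩, e₁, e₂⟩ :=
    h.separated (h3 u C₁ h₁) (h3 u C₂ h₂) (hint C₁ C₂ ⟨u, h₁⟩ ⟨u, h₂⟩ hC)
  refine ⟨?_, e₁, ?_, ?_, e₂, ?_⟩ <;> rintro rfl <;> contradiction

theorem pairKernel_of_edges {n : ℕ} {B : Fin n → Finset (Finset (Fin n))}
    {w : Finset (Fin n) → ℝ} (h3 : ∀ u, ∀ C ∈ B u, C.card = 3)
    (hdisj : ∀ u u', u ≠ u' → Disjoint (B u) (B u'))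
    (hint : ∀ C₁ C₂ : Finset (Fin n), (∃ u, C₁ ∈ B u) → (∃ u, C₂ ∈ B u) →
      C₁ ≠ C₂ → (C₁ ∩ C₂).card ≤ 1) {u : Fin n} {C₁ C₂ : Finset (Fin n)}
    (h₁ : C₁ ∈ B u) (h₂ : C₂ ∈ B u) (hC : C₁ ≠ C₂) {a b c d : Fin n}
    (h : EdgePair u C₁ C₂ a b c d) : pairKernel B w a b c d = w C₁ * w C₂ := by
  obtain ⟨⟨m₁, m₂, m₃, m₄⟩, -, e₁, e₂⟩ :=
    h.separated (h3 u C₁ h₁) (h3 u C₂ h₂) (hint C₁ C₂ ⟨u, h₁⟩ ⟨u, h₂⟩ hC)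
  have uniq : ∀ {v : Fin n} {D C : Finset (Fin n)}, D ∈ B v → C ∈ B u → ∀ {x y : Fin n},
      x ≠ y → x ∈ C → y ∈ C → x ∈ D → y ∈ D → D = C := by
    intro v D C hD hCu x y hxy hx hy hx' hy'
    by_contra hne
    exact hxy (Finset.eq_of_mem_inter_of_card_le_one (hint D C ⟨v, hD⟩ ⟨u, hCu⟩ hne)
      hx' hx hy' hy)
  have uniqv : ∀ {v : Fin n} {D : Finset (Fin n)}, D ∈ B v → D ∈ B u → v = u := by
    intro v D hD hD'
    by_contra hne
    exact Finset.disjoint_left.mp (hdisj v u hne) hD hD'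
  have zero : ∀ v, ∀ D₁ ∈ B v, ∀ D₂ ∈ B v, ¬ (v = u ∧ D₁ = C₁ ∧ D₂ = C₂) →
      (if D₁ ≠ D₂ ∧ EdgePair v D₁ D₂ a b c d then w D₁ * w D₂ else 0) = 0 := by
    intro v D₁ k₁ D₂ k₂ hne
    refine if_neg fun hh => hne ?_
    obtain ⟨⟨q₁, q₂, q₃, q₄⟩, -⟩ := hh.2.separated (h3 v D₁ k₁) (h3 v D₂ k₂)
      (hint D₁ D₂ ⟨v, k₁⟩ ⟨v, k₂⟩ hh.1)
    have E₁ := uniq k₁ h₁ e₁ m₁ m₂ q₁ q₂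
    have E₂ := uniq k₂ h₂ e₂ m₃ m₄ q₃ q₄
    exact ⟨uniqv k₁ (E₁ ▸ h₁), E₁, E₂⟩
  rw [pairKernel, Finset.sum_eq_single u, Finset.sum_eq_single_of_mem C₁ h₁,
    Finset.sum_eq_single_of_mem C₂ h₂, if_pos ⟨hC, h⟩]
  · exact fun D₂ k₂ hne => zero u C₁ h₁ D₂ k₂ fun e => hne e.2.2
  · exact fun D₁ k₁ hne => Finset.sum_eq_zero fun D₂ k₂ => zero u D₁ k₁ D₂ k₂ fun e => hne e.2.1
  · exact fun v _ hne => Finset.sum_eq_zero fun D₁ k₁ => Finset.sum_eq_zero fun D₂ k₂ =>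
      zero v D₁ k₁ D₂ k₂ fun e => hne e.1
  · simp

/-- The other endpoint of a labelled edge. -/
def flipEnd {Q : Type*} (x : Q × Bool) : Q × Bool := (x.1, !x.2)

@[simp] theorem flipEnd_flipEnd {Q : Type*} (x : Q × Bool) : flipEnd (flipEnd x) = x := by
  simp [flipEnd]

theorem flipEnd_ne {Q : Type*} (x : Q × Bool) : flipEnd x ≠ x := by
  simp [flipEnd, Prod.ext_iff]

theorem fst_eq_iff_eq_or_flipEnd {Q : Type*} {x y : Q × Bool} :
    x.1 = y.1 ↔ y = x ∨ y = flipEnd x := by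
  obtain ⟨p, s⟩ := x
  obtain ⟨q, t⟩ := y
  cases s <;> cases t <;> simp [flipEnd, eq_comm]

theorem exists_edge_labelling {n : ℕ} {B : Fin n → Finset (Finset (Fin n))}
    (hmem : ∀ u, ∀ C ∈ B u, C.card = 3 ∧ u ∈ C)
    (hint : ∀ C₁ C₂ : Finset (Fin n), (∃ u, C₁ ∈ B u) → (∃ u, C₂ ∈ B u) →
      C₁ ≠ C₂ → (C₁ ∩ C₂).card ≤ 1) (u : Fin n) :
    ∃ pt : {C // C ∈ B u} × Bool → Fin n, Function.Injective pt ∧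
      ∀ x, (x.1 : Finset (Fin n)) = {u, pt x, pt (flipEnd x)} := by
  have ex : ∀ C : {C // C ∈ B u}, ∃ v w, (C : Finset (Fin n)) = {u, v, w} := by
    rintro ⟨C, hC⟩
    obtain ⟨h3, hu⟩ := hmem u C hC
    have h2 : (C.erase u).card = 2 := by rw [Finset.card_erase_of_mem hu, h3]
    obtain ⟨v, w, -, h⟩ := Finset.card_eq_two.mp h2
    exact ⟨v, w, by rw [← h, Finset.insert_erase hu]⟩
  choose v w hvw using ex
  have hpt : ∀ x : {C // C ∈ B u} × Bool, (x.1 : Finset (Fin n)) =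
      {u, cond x.2 (w x.1) (v x.1), cond (flipEnd x).2 (w (flipEnd x).1) (v (flipEnd x).1)} := by
    rintro ⟨C, _ | _⟩
    · exact hvw C
    · rw [hvw C]
      simp [flipEnd, Finset.pair_comm]
  refine ⟨fun x => cond x.2 (w x.1) (v x.1), fun x y hxy => ?_, hpt⟩
  dsimp only at hxy
  have card_x := (hmem u _ x.1.2).1
  rw [hpt x] at card_x
  obtain ⟨hux, -, hne⟩ := Finset.ne_of_card_triple card_x
  have hfst : x.1 = y.1 := by
    by_contra hC
    refine hux (Finset.eq_of_mem_inter_of_card_le_one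
      (hint x.1 y.1 ⟨u, x.1.2⟩ ⟨u, y.1.2⟩ fun e => hC (Subtype.ext e)) (hmem u _ x.1.2).2
      (hmem u _ y.1.2).2 ?_ ?_)
    · rw [hpt x]; simp
    · rw [hpt y, ← hxy]; simp
  rcases fst_eq_iff_eq_or_flipEnd.mp hfst with h | h
  · exact h.symm
  · rw [h] at hxy
    exact absurd hxy hne

theorem exists_unit_vector_of_injective {Ω ι : Type*} [Fintype Ω] [Fintype ι] {Φ : Ω → ι}
    (hΦ : Function.Injective Φ) (ζ : Ω → ℝ) (hζ : ∑ f, ζ f ^ 2 = 1) :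
    ∃ z : ι → ℝ, ∑ S, z S ^ 2 = 1 ∧ ∀ A : ι → ι → ℝ,
      ∑ S, ∑ T, z S * A S T * z T = ∑ f, ∑ g, ζ f * A (Φ f) (Φ g) * ζ g := by
  have off : ∀ S, S ∉ Set.range Φ → Function.extend Φ ζ 0 S = 0 := fun S hS => by
    rw [Function.extend_apply' _ _ _ (by simpa using hS)]
    rfl
  refine ⟨Function.extend Φ ζ 0, ?_, fun A => ?_⟩
  · rw [← hζ]
    refine (Fintype.sum_of_injective Φ hΦ _ _ (fun S hS => ?_) fun f => ?_).symm
    · rw [off S hS]; simp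
    · rw [hΦ.extend_apply]
  · refine (Fintype.sum_of_injective Φ hΦ _ _ (fun S hS => ?_) fun f => ?_).symm
    · simp [off S hS]
    · refine Fintype.sum_of_injective Φ hΦ _ _ (fun S hS => ?_) fun g => ?_
      · simp [off S hS]
      · rw [hΦ.extend_apply, hΦ.extend_apply]

theorem sum_prod_eq_prod_sum {ι X : Type*} [Fintype ι] [Fintype X] (K : ι → X → ℝ) :
    ∑ S : ι → X, ∏ s, K s (S s) = ∏ s, ∑ x, K s x := by
  rw [Finset.prod_univ_sum, Fintype.piFinset_univ]

theorem sum_prod_sq {ι X : Type*} [Fintype ι] [Fintype X] {φ : X → ℝ}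
    (hφ : ∑ x, φ x ^ 2 = 1) : ∑ S : ι → X, (∏ s, φ (S s)) ^ 2 = 1 := by
  simp only [← Finset.prod_pow]
  rw [sum_prod_eq_prod_sum fun _ x => φ x ^ 2]
  simp [hφ]

/-- A product state sees a matrix supported on the coordinates in `I` only through `I`. -/
theorem sum_product_state_localized {ι X : Type*} [Fintype ι] [Fintype X] {φ : X → ℝ}
    (hφ : ∑ x, φ x ^ 2 = 1) (I : Finset ι) (a c : ι → X) :
    ∑ S : ι → X, ∑ T : ι → X, (∏ s, φ (S s)) * (∏ s, φ (T s)) *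
        (if ∀ s, if s ∈ I then S s = a s ∧ T s = c s else S s = T s then 1 else 0) =
      ∏ s ∈ I, φ (a s) * φ (c s) := by
  have h : ∀ S T : ι → X, (∏ s, φ (S s)) * (∏ s, φ (T s)) *
        (if ∀ s, if s ∈ I then S s = a s ∧ T s = c s else S s = T s then (1 : ℝ) else 0) =
      ∏ s, φ (S s) * φ (T s) *
        (if (if s ∈ I then S s = a s ∧ T s = c s else S s = T s) then 1 else 0) := by
    intro S T
    rw [Finset.prod_mul_distrib, Finset.prod_mul_distrib, Finset.prod_boole]
    simp
  simp only [h]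
  have h' : ∀ S : ι → X, ∑ T : ι → X, ∏ s, φ (S s) * φ (T s) *
        (if (if s ∈ I then S s = a s ∧ T s = c s else S s = T s) then (1 : ℝ) else 0) =
      ∏ s, ∑ y, φ (S s) * φ y *
        (if (if s ∈ I then S s = a s ∧ y = c s else S s = y) then 1 else 0) := fun S =>
    sum_prod_eq_prod_sum fun s y => φ (S s) * φ y *
        (if (if s ∈ I then S s = a s ∧ y = c s else S s = y) then 1 else 0)
  simp only [h']
  rw [sum_prod_eq_prod_sum fun s x => ∑ y, φ x * φ y *
        (if (if s ∈ I then x = a s ∧ y = c s else x = y) then 1 else 0),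
    ← Finset.prod_subset (Finset.subset_univ I)]
  · refine Finset.prod_congr rfl fun s hs => ?_
    simp [hs, ite_and]
  · intro s _ hs
    have hφ' : ∑ x, φ x * φ x = 1 := by simpa only [pow_two] using hφ
    simp [hs, hφ']

theorem sum_product_state_one_site {ι X : Type*} [Fintype ι] [Fintype X] {φ : X → ℝ}
    (hφ : ∑ x, φ x ^ 2 = 1) (p : ι) (h : X → X → ℝ) :
    ∑ S : ι → X, ∑ T : ι → X, (∏ s, φ (S s)) *
        (if ∀ s, s ≠ p → S s = T s then h (S p) (T p) else 0) * (∏ s, φ (T s)) =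
      ∑ x, ∑ y, φ x * φ y * h x y := by
  have e : ∀ S T : ι → X, (∏ s, φ (S s)) *
        (if ∀ s, s ≠ p → S s = T s then h (S p) (T p) else 0) * (∏ s, φ (T s)) =
      ∑ x, ∑ y, h x y * ((∏ s, φ (S s)) * (∏ s, φ (T s)) *
        (if ∀ s, if s ∈ ({p} : Finset ι) then S s = x ∧ T s = y else S s = T s
          then 1 else 0)) := by
    intro S T
    rw [Finset.sum_eq_single (S p), Finset.sum_eq_single (T p)]
    · have : (∀ s, if s ∈ ({p} : Finset ι) then S s = S p ∧ T s = T p else S s = T s) ↔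
          ∀ s, s ≠ p → S s = T s := by
        refine forall_congr' fun s => ?_
        by_cases hs : s = p <;> simp [hs]
      simp only [this]
      split_ifs <;> ring
    · intro y _ hy
      rw [if_neg, mul_zero, mul_zero]
      intro hh
      have := hh p
      simp only [Finset.mem_singleton, if_true] at this
      exact hy this.2.symm
    · simp
    · intro x _ hx
      refine Finset.sum_eq_zero fun y _ => ?_
      rw [if_neg, mul_zero, mul_zero]
      intro hh
      have := hh p
      simp only [Finset.mem_singleton, if_true] at this
      exact hx this.1.symm
    · simp
  simp only [e]
  rw [Finset.sum_congr rfl fun S _ => Finset.sum_comm, Finset.sum_comm]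
  refine Finset.sum_congr rfl fun x _ => ?_
  rw [Finset.sum_congr rfl fun S _ => Finset.sum_comm, Finset.sum_comm]
  refine Finset.sum_congr rfl fun y _ => ?_
  simp only [← Finset.mul_sum]
  rw [sum_product_state_localized hφ {p} (fun _ => x) fun _ => y]
  simp [mul_comm]

theorem sum_product_state_two_sites {ι X : Type*} [Fintype ι] [Fintype X] {φ : X → ℝ}
    (hφ : ∑ x, φ x ^ 2 = 1) {i j : ι} (hij : i ≠ j) (h : X → X → X → X → ℝ) :
    ∑ S : ι → X, ∑ T : ι → X, (∏ s, φ (S s)) *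
        (if ∀ s, s ≠ i → s ≠ j → S s = T s then h (S i) (S j) (T i) (T j) else 0) *
          (∏ s, φ (T s)) =
      ∑ x, ∑ y, ∑ x', ∑ y', φ x * φ y * φ x' * φ y' * h x y x' y' := by
  have e : ∀ S T : ι → X, (∏ s, φ (S s)) *
        (if ∀ s, s ≠ i → s ≠ j → S s = T s then h (S i) (S j) (T i) (T j) else 0) *
          (∏ s, φ (T s)) =
      ∑ q : X × X × X × X, h q.1 q.2.1 q.2.2.1 q.2.2.2 * ((∏ s, φ (S s)) * (∏ s, φ (T s)) *
        (if ∀ s, if s ∈ ({i, j} : Finset ι) then S s = (if s = i then q.1 else q.2.1) ∧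
          T s = (if s = i then q.2.2.1 else q.2.2.2) else S s = T s then 1 else 0)) := by
    intro S T
    rw [Finset.sum_eq_single (S i, S j, T i, T j)]
    · have : (∀ s, if s ∈ ({i, j} : Finset ι) then S s = (if s = i then S i else S j) ∧
          T s = (if s = i then T i else T j) else S s = T s) ↔
          ∀ s, s ≠ i → s ≠ j → S s = T s := by
        refine forall_congr' fun s => ?_
        by_cases hs : s = i
        · simp [hs]
        · by_cases hs' : s = j
          · simp [hs', hij.symm]
          · simp [hs, hs']
      simp only [this]
      split_ifs <;> ring
    · rintro ⟨x, y, x', y'⟩ _ hq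
      rw [if_neg, mul_zero, mul_zero]
      intro hh
      have h₁ := hh i
      have h₂ := hh j
      simp only [Finset.mem_insert, Finset.mem_singleton, true_or, or_true, if_true,
        hij.symm, if_false] at h₁ h₂
      exact hq (by rw [h₁.1, h₁.2, h₂.1, h₂.2])
    · simp
  simp only [e]
  rw [Finset.sum_congr rfl fun S _ => Finset.sum_comm, Finset.sum_comm]
  simp only [← Finset.mul_sum, Fintype.sum_prod_type]
  refine Finset.sum_congr rfl fun x _ => Finset.sum_congr rfl fun y _ =>
    Finset.sum_congr rfl fun x' _ => Finset.sum_congr rfl fun y' _ => ?_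
  rw [sum_product_state_localized hφ {i, j} (fun s => if s = i then x else y)
    fun s => if s = i then x' else y', Finset.prod_pair hij]
  simp only [if_true, hij.symm, if_false]
  ring

/-- The sign attached to a Boolean. -/
def boolSign (t : Bool) : ℝ := if t then -1 else 1

theorem boolSign_not (t : Bool) : boolSign (!t) = -boolSign t := by
  cases t <;> simp [boolSign]

theorem boolSign_mul_self (t : Bool) : boolSign t * boolSign t = 1 := by
  cases t <;> simp [boolSign]

theorem sum_boolSign_mul_eq_zero {Q : Type*} [Fintype Q] (p : Q) (F : (Q → Bool) → ℝ)
    (hF : ∀ ε, F (Function.update ε p (!ε p)) = F ε) : ∑ ε, boolSign (ε p) * F ε = 0 := by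
  have inv : Function.Involutive fun ε : Q → Bool => Function.update ε p (!ε p) := fun ε => by
    simp
  have h := Equiv.sum_comp inv.toPerm fun ε => boolSign (ε p) * F ε
  simp only [Function.Involutive.coe_toPerm, hF, Function.update_self, boolSign_not, neg_mul,
    Finset.sum_neg_distrib] at h
  linarith

theorem sum_boolSign_mul_boolSign {Q : Type*} [Fintype Q] {p q : Q} (hpq : p ≠ q) :
    ∑ ε : Q → Bool, boolSign (ε p) * boolSign (ε q) = 0 :=
  sum_boolSign_mul_eq_zero p _ fun ε => by simp [Function.update_of_ne hpq.symm]

theorem sum_boolSign_four {Q : Type*} [Fintype Q] (p q r t : Q) :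
    ∑ ε : Q → Bool, boolSign (ε p) * boolSign (ε q) * boolSign (ε r) * boolSign (ε t) =
      if (p = r ∧ q = t) ∨ (p = q ∧ r = t) ∨ (p = t ∧ q = r) then 2 ^ Fintype.card Q else 0 := by
  split_ifs with h
  · have : ∀ ε : Q → Bool,
        boolSign (ε p) * boolSign (ε q) * boolSign (ε r) * boolSign (ε t) = 1 := fun ε => by
      rcases h with ⟨h₁, h₂⟩ | ⟨h₁, h₂⟩ | ⟨h₁, h₂⟩ <;> rw [h₁, h₂]
      · linear_combination boolSign (ε r) * boolSign (ε r) * boolSign_mul_self (ε t) +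
          boolSign_mul_self (ε r)
      · linear_combination boolSign (ε q) * boolSign (ε q) * boolSign_mul_self (ε t) +
          boolSign_mul_self (ε q)
      · linear_combination boolSign (ε t) * boolSign (ε t) * boolSign_mul_self (ε r) +
          boolSign_mul_self (ε t)
    simp [this]
  · push Not at h
    obtain ⟨h₁, h₂, h₃⟩ := h
    by_cases hpq : p = q
    · subst hpq
      simp only [boolSign_mul_self, one_mul]
      exact sum_boolSign_mul_boolSign (h₂ rfl)
    by_cases hpr : p = r
    · subst hpr
      rw [← sum_boolSign_mul_boolSign (h₁ rfl)]
      refine Finset.sum_congr rfl fun ε _ => ?_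
      linear_combination (boolSign (ε q) * boolSign (ε t)) * boolSign_mul_self (ε p)
    by_cases hpt : p = t
    · subst hpt
      rw [← sum_boolSign_mul_boolSign (h₃ rfl)]
      refine Finset.sum_congr rfl fun ε _ => ?_
      linear_combination (boolSign (ε q) * boolSign (ε r)) * boolSign_mul_self (ε p)
    simp only [mul_assoc]
    exact sum_boolSign_mul_eq_zero p _ fun ε => by
      simp [Function.update_of_ne (Ne.symm hpq), Function.update_of_ne (Ne.symm hpr),
        Function.update_of_ne (Ne.symm hpt)]

/-- The correlation of a two-body kernel with the transitions that replace both ends of one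
edge by both ends of another. -/
noncomputable def edgeCorrelation {Q : Type*} [Fintype Q] (β : Q → ℝ)
    (h : Q × Bool → Q × Bool → Q × Bool → Q × Bool → ℝ) : ℝ :=
  ∑ x, ∑ y, β x.1 * β y.1 * h x (flipEnd x) y (flipEnd y)

/-- A vector on edge ends: the product over each edge `q` of its two values is `β q`. -/
def endWeight {Q : Type*} (β : Q → ℝ) (x : Q × Bool) : ℝ := if x.2 then β x.1 else 1

theorem endWeight_mul_flipEnd {Q : Type*} (β : Q → ℝ) (x : Q × Bool) :
    endWeight β x * endWeight β (flipEnd x) = β x.1 := by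
  obtain ⟨q, _ | _⟩ := x <;> simp [endWeight, flipEnd]

theorem flipEnd_involutive {Q : Type*} : Function.Involutive (flipEnd (Q := Q)) :=
  flipEnd_flipEnd

theorem sum_sum_fst_ne {Q : Type*} [Fintype Q] :
    ∑ x : Q × Bool, ∑ y : Q × Bool, (if x.1 ≠ y.1 then (1 : ℝ) else 0) =
      4 * Fintype.card Q * (Fintype.card Q - 1) := by
  have h : ∀ x y : Q × Bool, (if x.1 ≠ y.1 then (1 : ℝ) else 0) =
      1 - if x.1 = y.1 then 1 else 0 := fun x y => by
    split_ifs <;> simp_all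
  simp only [h, Finset.sum_sub_distrib, Fintype.sum_prod_type, Fintype.sum_bool,
    Finset.sum_add_distrib, Finset.sum_ite_eq, Finset.mem_univ, if_true, Finset.sum_const,
    Finset.card_univ, Fintype.card_prod, Fintype.card_bool, nsmul_eq_mul]
  push_cast
  ring

theorem ite_or_mul_eq {a a' b b' c c' : Prop} [Decidable a] [Decidable a'] [Decidable b]
    [Decidable b'] [Decidable c] [Decidable c'] (hac : a → ¬c) (hab : a → ¬b) (hbc : b → ¬c)
    (r w : ℝ) :
    (if (a ∧ a') ∨ (b ∧ b') ∨ (c' ∧ c) then r else 0) * w =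
      r * ((if a then if a' then w else 0 else 0) + (if b then if b' then w else 0 else 0) +
        (if c then if c' then w else 0 else 0)) := by
  by_cases ha : a
  · by_cases a' <;> simp_all
  by_cases hb : b
  · by_cases b' <;> simp_all
  by_cases c <;> by_cases c' <;> simp_all

theorem sum_sign_average {Q : Type*} [Fintype Q] {β : Q → ℝ} (hβ : ∀ q, β q * β q = 1)
    {h : Q × Bool → Q × Bool → Q × Bool → Q × Bool → ℝ}
    (hne : ∀ x y x' y', h x y x' y' ≠ 0 →
      x ≠ y ∧ x ≠ x' ∧ x ≠ y' ∧ y ≠ x' ∧ y ≠ y' ∧ x' ≠ y')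
    (hdiag : ∀ x y, x.1 ≠ y.1 → h x y (flipEnd x) (flipEnd y) = β x.1 * β y.1)
    (hcomm : ∀ x y x' y', h x y x' y' = h x y' x' y) :
    ∑ ε : Q → Bool, ∑ x, ∑ y, ∑ x', ∑ y',
      (boolSign (ε x.1) * endWeight β x) * (boolSign (ε y.1) * endWeight β y) *
        (boolSign (ε x'.1) * endWeight β x') * (boolSign (ε y'.1) * endWeight β y') *
        h x y x' y' =
      2 ^ Fintype.card Q *
        (4 * Fintype.card Q * (Fintype.card Q - 1) + 2 * edgeCorrelation β h) := by
  set W : Q × Bool → Q × Bool → Q × Bool → Q × Bool → ℝ := fun x y x' y' =>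
    endWeight β x * endWeight β y * endWeight β x' * endWeight β y' * h x y x' y' with hW
  have swap : ∀ F : (Q → Bool) → Q × Bool → Q × Bool → Q × Bool → Q × Bool → ℝ,
      ∑ ε, ∑ x, ∑ y, ∑ x', ∑ y', F ε x y x' y' = ∑ x, ∑ y, ∑ x', ∑ y', ∑ ε, F ε x y x' y' := by
    intro F
    rw [Finset.sum_comm]
    refine Finset.sum_congr rfl fun x _ => ?_
    rw [Finset.sum_comm]
    refine Finset.sum_congr rfl fun y _ => ?_
    rw [Finset.sum_comm]
    exact Finset.sum_congr rfl fun x' _ => Finset.sum_comm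
  have point : ∀ x y x' y', ∑ ε : Q → Bool,
      (boolSign (ε x.1) * endWeight β x) * (boolSign (ε y.1) * endWeight β y) *
        (boolSign (ε x'.1) * endWeight β x') * (boolSign (ε y'.1) * endWeight β y') *
        h x y x' y' = 2 ^ Fintype.card Q *
      ((if x' = flipEnd x then if y' = flipEnd y then W x y x' y' else 0 else 0) +
        (if y = flipEnd x then if y' = flipEnd x' then W x y x' y' else 0 else 0) +
        (if x' = flipEnd y then if y' = flipEnd x then W x y x' y' else 0 else 0)) := by
    intro x y x' y'
    have e : ∀ ε : Q → Bool,
      (boolSign (ε x.1) * endWeight β x) * (boolSign (ε y.1) * endWeight β y) *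
        (boolSign (ε x'.1) * endWeight β x') * (boolSign (ε y'.1) * endWeight β y') *
        h x y x' y' = (boolSign (ε x.1) * boolSign (ε y.1) * boolSign (ε x'.1) *
          boolSign (ε y'.1)) * W x y x' y' := fun ε => by rw [hW]; ring
    simp only [e]
    rw [← Finset.sum_mul, sum_boolSign_four]
    by_cases h0 : h x y x' y' = 0
    · simp [hW, h0]
    obtain ⟨n₁, n₂, n₃, n₄, n₅, n₆⟩ := hne x y x' y' h0
    have E₁ : x.1 = x'.1 ↔ x' = flipEnd x := by
      rw [fst_eq_iff_eq_or_flipEnd]; simp [n₂.symm]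
    have E₂ : y.1 = y'.1 ↔ y' = flipEnd y := by
      rw [fst_eq_iff_eq_or_flipEnd]; simp [n₅.symm]
    have E₃ : x.1 = y.1 ↔ y = flipEnd x := by
      rw [fst_eq_iff_eq_or_flipEnd]; simp [n₁.symm]
    have E₄ : x'.1 = y'.1 ↔ y' = flipEnd x' := by
      rw [fst_eq_iff_eq_or_flipEnd]; simp [n₆.symm]
    have E₅ : x.1 = y'.1 ↔ y' = flipEnd x := by
      rw [fst_eq_iff_eq_or_flipEnd]; simp [n₃.symm]
    have E₆ : y.1 = x'.1 ↔ x' = flipEnd y := by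
      rw [fst_eq_iff_eq_or_flipEnd]; simp [n₄.symm]
    rw [E₁, E₂, E₃, E₄, E₅, E₆]
    have k₁ : x' = flipEnd x → x' ≠ flipEnd y := fun a b =>
      n₁ (flipEnd_involutive.injective (a.symm.trans b))
    have k₂ : x' = flipEnd x → y ≠ flipEnd x := fun a b => n₄ (b.trans a.symm)
    have k₃ : y = flipEnd x → x' ≠ flipEnd y := fun a b => n₂ (by rw [b, a, flipEnd_flipEnd])
    convert ite_or_mul_eq (a := x' = flipEnd x) (a' := y' = flipEnd y) (b := y = flipEnd x)
      (b' := y' = flipEnd x') (c := x' = flipEnd y) (c' := y' = flipEnd x) k₁ k₂ k₃ _ _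
  rw [swap]
  simp only [point, ← Finset.mul_sum, Finset.sum_add_distrib]
  congr 1
  have S₁ : ∑ x, ∑ y, ∑ x', ∑ y', (if x' = flipEnd x then if y' = flipEnd y then W x y x' y'
      else 0 else 0) = 4 * Fintype.card Q * (Fintype.card Q - 1) := by
    rw [← sum_sum_fst_ne]
    refine Finset.sum_congr rfl fun x _ => Finset.sum_congr rfl fun y _ => ?_
    rw [Finset.sum_eq_single (flipEnd x) (fun x' _ hx' => by simp [hx']) (by simp)]
    simp only [if_true, Finset.sum_ite_eq', Finset.mem_univ]
    have : W x y (flipEnd x) (flipEnd y) = β x.1 * β y.1 * h x y (flipEnd x) (flipEnd y) := by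
      rw [← endWeight_mul_flipEnd β x, ← endWeight_mul_flipEnd β y, hW]; ring
    rw [this]
    split_ifs with hxy
    · rw [hdiag x y hxy]
      linear_combination (β y.1 * β y.1) * hβ x.1 + hβ y.1
    · by_contra h0
      obtain ⟨n₁, -, n₃, -⟩ := hne _ _ _ _ (right_ne_zero_of_mul h0)
      rcases fst_eq_iff_eq_or_flipEnd.mp (not_not.mp hxy) with e | e
      · exact n₁ e.symm
      · exact n₃ (by rw [e, flipEnd_flipEnd])
  have S₂ : ∑ x, ∑ y, ∑ x', ∑ y', (if y = flipEnd x then if y' = flipEnd x' then W x y x' y'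
      else 0 else 0) = edgeCorrelation β h := by
    refine Finset.sum_congr rfl fun x _ => ?_
    rw [Finset.sum_eq_single (flipEnd x) (fun y _ hy => by simp [hy]) (by simp)]
    simp only [if_true, Finset.sum_ite_eq', Finset.mem_univ]
    refine Finset.sum_congr rfl fun x' _ => ?_
    rw [← endWeight_mul_flipEnd β x, ← endWeight_mul_flipEnd β x', hW]; ring
  have S₃ : ∑ x, ∑ y, ∑ x', ∑ y', (if x' = flipEnd y then if y' = flipEnd x then W x y x' y'
      else 0 else 0) = edgeCorrelation β h := by
    refine Finset.sum_congr rfl fun x _ => ?_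
    rw [← Equiv.sum_comp flipEnd_involutive.toPerm]
    refine Finset.sum_congr rfl fun y _ => ?_
    simp only [Function.Involutive.coe_toPerm, flipEnd_flipEnd]
    rw [Finset.sum_eq_single y (fun x' _ hx' => by simp [hx']) (by simp)]
    simp only [if_true, Finset.sum_ite_eq', Finset.mem_univ]
    rw [← endWeight_mul_flipEnd β x, ← endWeight_mul_flipEnd β y, hW, hcomm x (flipEnd x)]
    ring
  rw [S₁, S₂, S₃]
  ring

/-- The matrix on configurations whose transitions move two positions by a kernel `K`, in
either order of the new values. -/
noncomputable def twoBodyMatrix {ι X : Type*} [Fintype ι] (K : X → X → X → X → ℝ)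
    (S T : ι → X) : ℝ :=
  1 / 2 * ∑ i, ∑ j, if i ≠ j ∧ ∀ s, s ≠ i → s ≠ j → S s = T s
    then K (S i) (S j) (T i) (T j) + K (S i) (S j) (T j) (T i) else 0

theorem sum_ite_ne {ι : Type*} [Fintype ι] (c : ℝ) :
    ∑ i : ι, ∑ j : ι, (if i ≠ j then c else 0) =
      Fintype.card ι * (Fintype.card ι - 1) * c := by
  have h : ∀ i j : ι, (if i ≠ j then c else 0) = c - if i = j then c else 0 := fun i j => by
    split_ifs <;> simp_all
  simp only [h, Finset.sum_sub_distrib, Finset.sum_const, Finset.card_univ, nsmul_eq_mul,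
    Finset.sum_ite_eq, Finset.mem_univ, if_true]
  ring

theorem sum_product_state_twoBodyMatrix {ι X Y : Type*} [Fintype ι] [Fintype Y]
    (K : X → X → X → X → ℝ) {pt : Y → X} (hpt : Function.Injective pt) {φ : Y → ℝ}
    (hφ : ∑ x, φ x ^ 2 = 1) :
    ∑ f : ι → Y, ∑ g : ι → Y, (∏ s, φ (f s)) * twoBodyMatrix K (pt ∘ f) (pt ∘ g) *
        (∏ s, φ (g s)) =
      Fintype.card ι * (Fintype.card ι - 1) * ∑ x, ∑ y, ∑ x', ∑ y',
        φ x * φ y * φ x' * φ y' * K (pt x) (pt y) (pt x') (pt y') := by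
  set θ := ∑ x, ∑ y, ∑ x', ∑ y',
    φ x * φ y * φ x' * φ y' * K (pt x) (pt y) (pt x') (pt y') with hθ
  have pull : ∀ f g : ι → Y, (∏ s, φ (f s)) * twoBodyMatrix K (pt ∘ f) (pt ∘ g) *
        (∏ s, φ (g s)) = 1 / 2 * ∑ i, ∑ j, (∏ s, φ (f s)) *
        (if i ≠ j then if ∀ s, s ≠ i → s ≠ j → f s = g s then
          K (pt (f i)) (pt (f j)) (pt (g i)) (pt (g j)) +
            K (pt (f i)) (pt (f j)) (pt (g j)) (pt (g i)) else 0 else 0) *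
        (∏ s, φ (g s)) := by
    intro f g
    simp only [twoBodyMatrix, Function.comp_apply, hpt.eq_iff, ite_and, Finset.mul_sum,
      Finset.sum_mul]
    refine Finset.sum_congr rfl fun i _ => Finset.sum_congr rfl fun j _ => ?_
    ring
  simp only [pull, ← Finset.mul_sum]
  have term : ∀ i j : ι, (∑ f : ι → Y, ∑ g : ι → Y, (∏ s, φ (f s)) *
        (if i ≠ j then if ∀ s, s ≠ i → s ≠ j → f s = g s then
          K (pt (f i)) (pt (f j)) (pt (g i)) (pt (g j)) +
            K (pt (f i)) (pt (f j)) (pt (g j)) (pt (g i)) else 0 else 0) *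
        (∏ s, φ (g s))) = if i ≠ j then 2 * θ else 0 := by
    intro i j
    by_cases hij : i = j
    · simp [hij]
    simp only [if_pos hij]
    rw [sum_product_state_two_sites hφ hij fun x y x' y' =>
      K (pt x) (pt y) (pt x') (pt y') + K (pt x) (pt y) (pt y') (pt x')]
    simp only [mul_add, Finset.sum_add_distrib, two_mul]
    rw [← hθ]
    congr 1
    refine Finset.sum_congr rfl fun x _ => Finset.sum_congr rfl fun y _ => ?_
    rw [Finset.sum_comm]
    refine Finset.sum_congr rfl fun x' _ => Finset.sum_congr rfl fun y' _ => ?_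
    ring
  have comm : ∀ F : ι → ι → (ι → Y) → (ι → Y) → ℝ,
      ∑ f, ∑ g, ∑ i, ∑ j, F i j f g = ∑ i, ∑ j, ∑ f, ∑ g, F i j f g := by
    intro F
    rw [Finset.sum_congr rfl fun f _ => Finset.sum_comm, Finset.sum_comm]
    refine Finset.sum_congr rfl fun i _ => ?_
    rw [Finset.sum_congr rfl fun f _ => Finset.sum_comm, Finset.sum_comm]
  rw [comm]
  simp only [term, sum_ite_ne]
  ring

set_option maxHeartbeats 1000000 in
theorem exists_unit_vector_of_edge_signs {ι X Q : Type*} [Fintype ι] [Fintype (ι → X)]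
    [Fintype Q] [Nonempty Q] {K : X → X → X → X → ℝ} {pt : Q × Bool → X} (hpt : Function.Injective pt)
    {β : Q → ℝ} (hβ : ∀ q, β q * β q = 1)
    (hne : ∀ a b c d, K a b c d ≠ 0 → a ≠ b ∧ a ≠ c ∧ a ≠ d ∧ b ≠ c ∧ b ≠ d ∧ c ≠ d)
    (hdiag : ∀ x y, x.1 ≠ y.1 →
      K (pt x) (pt y) (pt (flipEnd x)) (pt (flipEnd y)) = β x.1 * β y.1)
    (hcomm : ∀ a b c d, K a b c d = K a d c b) :
    ∃ z : (ι → X) → ℝ, ∑ S, z S ^ 2 = 1 ∧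
      Fintype.card ι * (Fintype.card ι - 1) * (2 * Fintype.card Q * (Fintype.card Q - 1) +
        edgeCorrelation β fun x y x' y' => K (pt x) (pt y) (pt x') (pt y')) /
          (2 * Fintype.card Q ^ 2) ≤ ∑ S, ∑ T, z S * twoBodyMatrix K S T * z T := by
  set k : ℝ := ((Fintype.card Q : ℕ) : ℝ) with hk
  have kpos : 0 < k := by rw [hk]; exact_mod_cast Fintype.card_pos
  have avg := sum_sign_average hβ (h := fun x y x' y' => K (pt x) (pt y) (pt x') (pt y'))
    (fun x y x' y' h0 => by
      obtain ⟨h₁, h₂, h₃, h₄, h₅, h₆⟩ := hne _ _ _ _ h0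
      exact ⟨fun e => h₁ (congrArg pt e), fun e => h₂ (congrArg pt e),
        fun e => h₃ (congrArg pt e), fun e => h₄ (congrArg pt e),
        fun e => h₅ (congrArg pt e), fun e => h₆ (congrArg pt e)⟩)
    hdiag fun x y x' y' => hcomm _ _ _ _
  set D := edgeCorrelation β fun x y x' y' => K (pt x) (pt y) (pt x') (pt y')
  obtain ⟨ε, -, hε⟩ := Finset.exists_le_of_sum_le (s := (Finset.univ : Finset (Q → Bool)))
    (f := fun _ => 4 * k * (k - 1) + 2 * D) Finset.univ_nonempty
    (le_of_eq (by rw [avg]; simp [hk]; ring))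
  have c2 : (√(2 * k))⁻¹ ^ 2 = (2 * k)⁻¹ := by
    rw [inv_pow, Real.sq_sqrt (by positivity)]
  set c := (√(2 * k))⁻¹
  have sq : ∀ x : Q × Bool, (boolSign (ε x.1) * endWeight β x) ^ 2 = 1 := fun x => by
    have : endWeight β x * endWeight β x = 1 := by
      unfold endWeight
      split_ifs
      · exact hβ _
      · norm_num
    linear_combination (endWeight β x * endWeight β x) * boolSign_mul_self (ε x.1) + this
  have hφ : ∑ x : Q × Bool, (c * (boolSign (ε x.1) * endWeight β x)) ^ 2 = 1 := by
    simp only [mul_pow c, sq, c2, mul_one, Finset.sum_const, Finset.card_univ,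
      Fintype.card_prod, Fintype.card_bool, nsmul_eq_mul]
    push_cast
    rw [← hk]
    field_simp
  obtain ⟨z, hz, hzA⟩ := exists_unit_vector_of_injective
    (Φ := fun f : ι → Q × Bool => pt ∘ f) hpt.comp_left
    (fun f => ∏ s, c * (boolSign (ε (f s).1) * endWeight β (f s))) (sum_prod_sq hφ)
  refine ⟨z, hz, ?_⟩
  rw [hzA, sum_product_state_twoBodyMatrix K hpt hφ]
  have scale : ∑ x, ∑ y, ∑ x', ∑ y',
      c * (boolSign (ε x.1) * endWeight β x) * (c * (boolSign (ε y.1) * endWeight β y)) *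
        (c * (boolSign (ε x'.1) * endWeight β x')) *
        (c * (boolSign (ε y'.1) * endWeight β y')) * K (pt x) (pt y) (pt x') (pt y') =
      (2 * k)⁻¹ ^ 2 * ∑ x, ∑ y, ∑ x', ∑ y',
      (boolSign (ε x.1) * endWeight β x) * (boolSign (ε y.1) * endWeight β y) *
        (boolSign (ε x'.1) * endWeight β x') * (boolSign (ε y'.1) * endWeight β y') *
        K (pt x) (pt y) (pt x') (pt y') := by
    simp only [Finset.mul_sum, ← c2]
    refine Finset.sum_congr rfl fun x _ => Finset.sum_congr rfl fun y _ =>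
      Finset.sum_congr rfl fun x' _ => Finset.sum_congr rfl fun y' _ => ?_
    ring
  rw [scale]
  have card_nonneg : (0 : ℝ) ≤ Fintype.card ι * (Fintype.card ι - 1) := by
    rcases Nat.eq_zero_or_pos (Fintype.card ι) with h | h
    · simp [h]
    · have : (1 : ℝ) ≤ Fintype.card ι := by exact_mod_cast h
      exact mul_nonneg (by linarith) (by linarith)
  refine le_trans (le_of_eq ?_) (mul_le_mul_of_nonneg_left
    (mul_le_mul_of_nonneg_left hε (sq_nonneg (2 * k)⁻¹)) card_nonneg)
  field_simp
  ring

/-- The configuration placing the two ends of the edge end `f p` at the two positions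
`e (p, false)` and `e (p, true)`, and `u` everywhere else. -/
noncomputable def pairConfig {P ι X Q : Type*} (e : P × Bool → ι) (pt : Q × Bool → X) (u : X)
    (f : P → Q × Bool) : ι → X :=
  Function.extend e (fun x => pt (if x.2 then flipEnd (f x.1) else f x.1)) fun _ => u

section PairConfig

variable {P ι X Q : Type*} {e : P × Bool → ι} {pt : Q × Bool → X} {u : X}

theorem pairConfig_apply (he : Function.Injective e) (f : P → Q × Bool) (x : P × Bool) :
    pairConfig e pt u f (e x) = pt (if x.2 then flipEnd (f x.1) else f x.1) :=
  he.extend_apply _ _ _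

theorem pairConfig_apply_eq_iff (he : Function.Injective e) (hpt : Function.Injective pt)
    (f g : P → Q × Bool) (x : P × Bool) :
    pairConfig e pt u f (e x) = pairConfig e pt u g (e x) ↔ f x.1 = g x.1 := by
  rw [pairConfig_apply he, pairConfig_apply he, hpt.eq_iff]
  split_ifs
  · exact flipEnd_involutive.injective.eq_iff
  · rfl

theorem pairConfig_injective (he : Function.Injective e) (hpt : Function.Injective pt) :
    Function.Injective (pairConfig e pt u) := fun f g h => funext fun p =>
  (pairConfig_apply_eq_iff he hpt f g (p, false)).mp (congrFun h _)

theorem pairConfig_agree_off_iff (he : Function.Injective e) (hpt : Function.Injective pt)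
    (f g : P → Q × Bool) (x : P × Bool) :
    (∀ s, s ≠ e x → s ≠ e (flipEnd x) → pairConfig e pt u f s = pairConfig e pt u g s) ↔
      ∀ p, p ≠ x.1 → f p = g p := by
  constructor
  · intro h p hp
    refine (pairConfig_apply_eq_iff he hpt f g (p, false)).mp (h _ (fun hh => ?_) fun hh => ?_)
    · exact hp (congrArg Prod.fst (he hh))
    · exact hp (congrArg Prod.fst (he hh))
  · intro h s hs hs'
    by_cases hr : ∃ y, e y = s
    · obtain ⟨y, rfl⟩ := hr
      refine (pairConfig_apply_eq_iff he hpt f g y).mpr (h _ fun hy => ?_)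
      rcases fst_eq_iff_eq_or_flipEnd.mp hy.symm with rfl | rfl
      · exact hs rfl
      · exact hs' rfl
    · rw [pairConfig, pairConfig, Function.extend_apply' _ _ _ hr, Function.extend_apply' _ _ _ hr]

theorem twoBodyMatrix_pairConfig [Fintype P] [Fintype ι] {K : X → X → X → X → ℝ}
    (he : Function.Injective e) (hpt : Function.Injective pt)
    (hne : ∀ a b c d, K a b c d ≠ 0 → a ≠ b ∧ a ≠ c ∧ a ≠ d ∧ b ≠ c ∧ b ≠ d ∧ c ≠ d)
    (hswap : ∀ a b c d, K a b c d = K b a d c) (f g : P → Q × Bool) :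
    twoBodyMatrix K (pairConfig e pt u f) (pairConfig e pt u g) =
      ∑ p, if ∀ q, q ≠ p → f q = g q then
        K (pt (f p)) (pt (flipEnd (f p))) (pt (g p)) (pt (flipEnd (g p))) +
          K (pt (f p)) (pt (flipEnd (f p))) (pt (flipEnd (g p))) (pt (g p)) else 0 := by
  have diff : ∀ i, pairConfig e pt u f i ≠ pairConfig e pt u g i → ∃ x, e x = i := by
    intro i hi
    by_contra hr
    exact hi (by
      rw [pairConfig, pairConfig, Function.extend_apply' _ _ _ hr,
        Function.extend_apply' _ _ _ hr])
  set F : ι × ι → ℝ := fun q =>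
    if q.1 ≠ q.2 ∧ ∀ s, s ≠ q.1 → s ≠ q.2 → pairConfig e pt u f s = pairConfig e pt u g s
    then K (pairConfig e pt u f q.1) (pairConfig e pt u f q.2) (pairConfig e pt u g q.1)
        (pairConfig e pt u g q.2) +
      K (pairConfig e pt u f q.1) (pairConfig e pt u f q.2) (pairConfig e pt u g q.2)
        (pairConfig e pt u g q.1) else 0 with hF
  have off : ∀ q, q ∉ Set.range (fun x => (e x, e (flipEnd x))) → F q = 0 := by
    rintro ⟨i, j⟩ hq
    by_contra h0
    obtain ⟨⟨hij, hag⟩, h0⟩ := ite_ne_right_iff.mp h0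
    have hi : pairConfig e pt u f i ≠ pairConfig e pt u g i := by
      intro heq
      refine h0 ?_
      dsimp only
      rw [heq, not_not.mp fun h => (hne _ _ _ _ h).2.1 rfl,
        not_not.mp fun h => (hne _ _ _ _ h).2.2.1 rfl, add_zero]
    obtain ⟨x, rfl⟩ := diff i hi
    refine hq ⟨x, Prod.ext rfl ?_⟩
    by_contra hj
    refine hi ((pairConfig_apply_eq_iff he hpt f g x).mpr ?_)
    exact (pairConfig_apply_eq_iff he hpt f g (flipEnd x)).mp
      (hag _ (fun h => flipEnd_ne x (he h)) hj)
  have inj : Function.Injective (fun x => (e x, e (flipEnd x))) := fun x y h =>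
    he (congrArg Prod.fst h)
  have sum : ∑ q, F q = ∑ x, F (e x, e (flipEnd x)) :=
    (Fintype.sum_of_injective _ inj _ _ off fun _ => rfl).symm
  rw [Fintype.sum_prod_type] at sum
  rw [twoBodyMatrix]
  refine (congrArg (fun t => 1 / 2 * t) sum).trans ?_
  rw [Fintype.sum_prod_type, Finset.mul_sum]
  refine Finset.sum_congr rfl fun p _ => ?_
  have hF' : ∀ x : P × Bool, F (e x, e (flipEnd x)) = if ∀ q, q ≠ x.1 → f q = g q then
      K (pairConfig e pt u f (e x)) (pairConfig e pt u f (e (flipEnd x)))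
        (pairConfig e pt u g (e x)) (pairConfig e pt u g (e (flipEnd x))) +
      K (pairConfig e pt u f (e x)) (pairConfig e pt u f (e (flipEnd x)))
        (pairConfig e pt u g (e (flipEnd x))) (pairConfig e pt u g (e x)) else 0 := by
    intro x
    have hx : e x ≠ e (flipEnd x) := fun h => flipEnd_ne x (he h).symm
    refine if_congr ?_ rfl rfl
    rw [pairConfig_agree_off_iff he hpt]
    exact and_iff_right hx
  rw [Fintype.sum_bool, hF', hF']
  simp only [pairConfig_apply he, flipEnd, Bool.not_true, Bool.not_false, if_true,
    Bool.false_eq_true, if_false]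
  split_ifs
  · rw [hswap (pt ((f p).1, !(f p).2)), hswap (pt ((f p).1, !(f p).2))]
    ring
  · simp

set_option maxHeartbeats 1000000 in
theorem exists_unit_vectors_of_edge_pairs [Fintype P] [Fintype ι] [Fintype (ι → X)]
    [Fintype Q] [Nonempty Q] {K : X → X → X → X → ℝ} (he : Function.Injective e)
    (hpt : Function.Injective pt) (u : X) {β : Q → ℝ} (hβ : ∀ q, β q * β q = 1)
    (hne : ∀ a b c d, K a b c d ≠ 0 → a ≠ b ∧ a ≠ c ∧ a ≠ d ∧ b ≠ c ∧ b ≠ d ∧ c ≠ d)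
    (hswap : ∀ a b c d, K a b c d = K b a d c) :
    ∃ z w : (ι → X) → ℝ, ∑ S, z S ^ 2 = 1 ∧ ∑ S, w S ^ 2 = 1 ∧
      ∑ S, ∑ T, z S * twoBodyMatrix K S T * w T =
        Fintype.card P * -(edgeCorrelation β fun x y x' y' =>
          K (pt x) (pt y) (pt x') (pt y')) / Fintype.card Q := by
  set k : ℝ := ((Fintype.card Q : ℕ) : ℝ) with hk
  have kpos : 0 < k := by rw [hk]; exact_mod_cast Fintype.card_pos
  have c2 : (√(2 * k))⁻¹ ^ 2 = (2 * k)⁻¹ := by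
    rw [inv_pow, Real.sq_sqrt (by positivity)]
  set c := (√(2 * k))⁻¹
  have hφ : ∑ x : Q × Bool, (c * β x.1) ^ 2 = 1 := by
    have sq : ∀ q, β q ^ 2 = 1 := fun q => by rw [pow_two, hβ]
    simp only [mul_pow c, sq, c2, mul_one, Finset.sum_const, Finset.card_univ,
      Fintype.card_prod, Fintype.card_bool, nsmul_eq_mul]
    push_cast
    rw [← hk]
    field_simp
  obtain ⟨z, hz, hzA⟩ := exists_unit_vector_of_injective
    (Φ := pairConfig e pt u) (pairConfig_injective he hpt)
    (fun f => ∏ p, c * β (f p).1) (sum_prod_sq hφ)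
  refine ⟨z, -z, hz, by simpa using hz, ?_⟩
  simp only [Pi.neg_apply, mul_neg, Finset.sum_neg_distrib, neg_div]
  rw [hzA]
  congr 1
  simp only [twoBodyMatrix_pairConfig he hpt hne hswap, Finset.mul_sum, Finset.sum_mul]
  rw [Finset.sum_congr rfl fun f _ => Finset.sum_comm, Finset.sum_comm]
  set D := edgeCorrelation β fun x y x' y' => K (pt x) (pt y) (pt x') (pt y') with hD
  have D₁ : ∑ x : Q × Bool, ∑ y : Q × Bool,
      β x.1 * β y.1 * K (pt x) (pt (flipEnd x)) (pt y) (pt (flipEnd y)) = D := rfl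
  have D₂ : ∑ x : Q × Bool, ∑ y : Q × Bool,
      β x.1 * β y.1 * K (pt x) (pt (flipEnd x)) (pt (flipEnd y)) (pt y) = D := by
    rw [← D₁]
    refine Finset.sum_congr rfl fun x _ => ?_
    rw [← Equiv.sum_comp flipEnd_involutive.toPerm]
    simp only [Function.Involutive.coe_toPerm, flipEnd_flipEnd]
    rfl
  have : ∑ x : Q × Bool, ∑ y : Q × Bool, c * β x.1 * (c * β y.1) *
      (K (pt x) (pt (flipEnd x)) (pt y) (pt (flipEnd y)) +
        K (pt x) (pt (flipEnd x)) (pt (flipEnd y)) (pt y)) = c ^ 2 * (D + D) := by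
    nth_rewrite 1 [← D₁]
    rw [← D₂]
    simp only [← Finset.sum_add_distrib, Finset.mul_sum]
    refine Finset.sum_congr rfl fun x _ => Finset.sum_congr rfl fun y _ => ?_
    ring
  refine (Finset.sum_congr (g := fun _ : P => D / k) rfl fun p _ => ?_).trans
    (by simp [mul_div_assoc])
  have site := sum_product_state_one_site hφ p fun x y =>
    K (pt x) (pt (flipEnd x)) (pt y) (pt (flipEnd y)) +
      K (pt x) (pt (flipEnd x)) (pt (flipEnd y)) (pt y)
  rw [this, c2] at site
  rw [← two_mul, inv_mul_eq_div, mul_div_mul_left _ _ two_ne_zero] at site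
  convert site

end PairConfig

/-- Two distinct positions of `Fin ℓ` for each index below `ℓ / 2`. -/
def consecutivePair (ℓ : ℕ) (x : Fin (ℓ / 2) × Bool) : Fin ℓ :=
  ⟨2 * x.1 + x.2.toNat, by have := x.1.isLt; have := x.2.toNat_le; omega⟩

theorem consecutivePair_injective (ℓ : ℕ) : Function.Injective (consecutivePair ℓ) := by
  rintro ⟨p, s⟩ ⟨q, t⟩ h
  have h' : 2 * (p : ℕ) + s.toNat = 2 * q + t.toNat := congrArg Fin.val h
  have hp : p = q := by
    have := s.toNat_le
    have := t.toNat_le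
    exact Fin.ext (by omega)
  subst hp
  have hs : s.toNat = t.toNat := by omega
  cases s <;> cases t <;> simp_all

theorem mul_sub_one_le_of_two_mul_le {L k h : ℕ} (hk : 2 ≤ k) (hLk : 2 * L ≤ k + 1)
    (hLh : L ≤ 2 * h + 1) : (L : ℝ) * (L - 1) / 2 ≤ h * (k - 2) := by
  have hk' : (2 : ℝ) ≤ k := by exact_mod_cast hk
  have hLk' : (2 : ℝ) * L ≤ k + 1 := by exact_mod_cast hLk
  have hLh' : (L : ℝ) ≤ 2 * h + 1 := by exact_mod_cast hLh
  have h0 : (0 : ℝ) ≤ h := Nat.cast_nonneg h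
  have nonneg : 0 ≤ (h : ℝ) * (k - 2) := mul_nonneg h0 (by linarith)
  rcases Nat.lt_or_ge L 3 with hL | hL
  · interval_cases L
    · simpa using nonneg
    · simpa using nonneg
    · have h1 : (1 : ℝ) ≤ h := by exact_mod_cast (by omega : 1 ≤ h)
      push_cast at *
      nlinarith
  · have hL' : (3 : ℝ) ≤ L := by exact_mod_cast hL
    nlinarith [mul_le_mul (by linarith : ((L : ℝ) - 1) / 2 ≤ h)
      (by linarith : (2 : ℝ) * L - 3 ≤ k - 2) (by linarith) h0]

theorem exists_card_mul_ge {n : ℕ} (hn : 0 < n) (B : Fin n → Finset (Finset (Fin n))) :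
    ∃ u, ∑ v, (B v).card ≤ n * (B u).card := by
  by_contra! h
  have : Nonempty (Fin n) := ⟨⟨0, hn⟩⟩
  have := Finset.sum_lt_sum_of_nonempty (s := Finset.univ) Finset.univ_nonempty fun u _ => h u
  rw [← Finset.mul_sum] at this
  simp at this

/-- For `n, m, ℓ` positive with `2n ≤ m`, `ℓ ≤ n`, a 3-uniform
hypergraph on `[n]` with `m` hyperedges partitioned into `B u` (`u ∈ C` for every
`C ∈ B u`) with pairwise intersections of hyperedges of size at most 1, and arbitrary
signs `b_C ∈ {−1,1}`: the spectral norm of the associated Kikuchi matrix is at least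
`ℓ'(ℓ'−1)/2` with `ℓ' = min(⌈m/(2n)⌉, ℓ)`, witnessed by unit vectors `z, w` with
`zᵀ A w ≥ ℓ'(ℓ'−1)/2`. -/
theorem wam_matrix_large_norm
    (n m ℓ : ℕ) (hn : 0 < n) (hm : 0 < m) (hℓ : 0 < ℓ)
    (h2n : 2*n ≤ m) (hℓn : ℓ ≤ n)
    (B : Fin n → Finset (Finset (Fin n)))
    (hmE : m = ∑ u, (B u).card)
    (hmem : ∀ u, ∀ C ∈ B u, C.card = 3 ∧ u ∈ C)
    (hdisj : ∀ u u', u ≠ u' → Disjoint (B u) (B u'))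
    (hint : ∀ C₁ C₂ : Finset (Fin n), (∃ u, C₁ ∈ B u) → (∃ u, C₂ ∈ B u) →
      C₁ ≠ C₂ → (C₁ ∩ C₂).card ≤ 1)
    (b : Finset (Fin n) → ℝ) (hb : ∀ C, b C = 1 ∨ b C = -1) :
    ∃ z w : (Fin ℓ → Fin n) → ℝ,
      (∑ S, (z S)^2 = 1) ∧ (∑ S, (w S)^2 = 1) ∧
      ((min ⌈(m:ℝ)/(2*(n:ℝ))⌉₊ ℓ : ℕ) : ℝ) * (((min ⌈(m:ℝ)/(2*(n:ℝ))⌉₊ ℓ : ℕ) : ℝ) - 1) / 2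
        ≤ ∑ S, ∑ T, z S * wamMatrix n ℓ B b S T * w T := by
  have h3 : ∀ u, ∀ C ∈ B u, C.card = 3 := fun u C hC => (hmem u C hC).1
  obtain ⟨u, hu⟩ := exists_card_mul_ge hn B
  rw [← hmE] at hu
  set k := (B u).card with hk
  have hk2 : 2 ≤ k := Nat.le_of_mul_le_mul_left (by linarith) hn
  set L := min ⌈(m : ℝ) / (2 * (n : ℝ))⌉₊ ℓ with hL
  have hn' : (0 : ℝ) < n := by exact_mod_cast hn
  have hLk : 2 * L ≤ k + 1 := by
    have h₁ : (L : ℝ) < (m : ℝ) / (2 * n) + 1 :=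
      lt_of_le_of_lt (Nat.cast_le.mpr (min_le_left _ _)) (Nat.ceil_lt_add_one (by positivity))
    have h₂ : (m : ℝ) / (2 * n) ≤ k / 2 := by
      have : (m : ℝ) ≤ n * k := by exact_mod_cast hu
      rw [div_le_div_iff₀ (by positivity) two_pos]
      linarith
    have h₃ : (2 : ℝ) * L < k + 2 := by linarith
    have h₄ : 2 * L < k + 2 := by exact_mod_cast h₃
    omega
  have hLℓ : L ≤ ℓ := min_le_right _ _
  clear_value L
  obtain ⟨pt, hpt, hedge⟩ := exists_edge_labelling hmem hint u
  have hcard : Fintype.card {C // C ∈ B u} = k := by simp [hk]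
  have : Nonempty {C // C ∈ B u} := Fintype.card_pos_iff.mp (by omega)
  have hβ : ∀ q : {C // C ∈ B u}, b q * b q = 1 := fun q => by
    rcases hb q with h | h <;> simp [h]
  have hA : ∀ S T, wamMatrix n ℓ B b S T = twoBodyMatrix (pairKernel B b) S T := fun S T => by
    rw [wamMatrix_eq_sum_pairKernel b h3 hint, twoBodyMatrix]
    congr!
  have hne : ∀ a b' c d, pairKernel B b a b' c d ≠ 0 →
      a ≠ b' ∧ a ≠ c ∧ a ≠ d ∧ b' ≠ c ∧ b' ≠ d ∧ c ≠ d := fun _ _ _ _ h =>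
    ne_of_pairKernel_ne_zero h3 hint h
  simp only [hA]
  set D := edgeCorrelation (fun q : {C // C ∈ B u} => b q) fun x y x' y' =>
    pairKernel B b (pt x) (pt y) (pt x') (pt y') with hD
  have hk' : (2 : ℝ) ≤ k := by exact_mod_cast hk2
  by_cases hcase : (k : ℝ) ^ 2 ≤ 2 * k * (k - 1) + D
  · obtain ⟨z, hz, hzA⟩ := exists_unit_vector_of_edge_signs (ι := Fin ℓ) hpt hβ hne
      (fun x y hxy => pairKernel_of_edges h3 hdisj hint x.1.2 y.1.2
        (fun h => hxy (Subtype.ext h)) ⟨hedge x, hedge y⟩) (pairKernel_comm_snd B b)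
    refine ⟨z, z, hz, hz, le_trans ?_ hzA⟩
    rw [hcard, Fintype.card_fin, ← hD]
    have hLL : (L : ℝ) * (L - 1) ≤ ℓ * (ℓ - 1) := by
      have h₁ : (L : ℝ) ≤ ℓ := by exact_mod_cast hLℓ
      have h₂ : (1 : ℝ) ≤ ℓ := by exact_mod_cast hℓ
      rcases Nat.eq_zero_or_pos L with h | h
      · simp only [h, Nat.cast_zero, zero_mul]
        nlinarith
      · have : (1 : ℝ) ≤ L := by exact_mod_cast h
        nlinarith
    have hℓℓ : (0 : ℝ) ≤ ℓ * (ℓ - 1) := by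
      have h₂ : (1 : ℝ) ≤ ℓ := by exact_mod_cast hℓ
      nlinarith
    rw [div_le_div_iff₀ two_pos (by positivity)]
    nlinarith [mul_le_mul_of_nonneg_left hcase hℓℓ,
      mul_le_mul_of_nonneg_right hLL (sq_nonneg (k : ℝ))]
  · obtain ⟨z, w, hz, hw, hzw⟩ := exists_unit_vectors_of_edge_pairs
      (consecutivePair_injective ℓ) hpt u hβ hne (pairKernel_swap B b)
    refine ⟨z, w, hz, hw, ?_⟩
    rw [hzw, hcard, Fintype.card_fin, ← hD, mul_div_assoc _ (-D)]
    refine (mul_sub_one_le_of_two_mul_le hk2 hLk (by omega : L ≤ 2 * (ℓ / 2) + 1)).trans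
      (mul_le_mul_of_nonneg_left ?_ (Nat.cast_nonneg _))
    rw [le_div_iff₀ (by linarith)]
    nlinarith
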